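/- arXiv:2605.15685 — 7 statements merged into one kernel-verified Lean document; each statement's English description precedes it below -/
import Mathlib

section
/- Let K be a finite abstract simplicial complex with weight function w and let e = {v₁, v₂} be a 1-simplex of K. Then the Forman–Ricci curvature simplifies to F(e) = w(e)·[Σ_{T ∈ cof₂(e)} w(e)/w(T) + w(v₁)/w(e) + w(v₂)/w(e) − Σ_{ê ∈ P(e)} w(v(ê))/√(w(e)·w(ê))]; that is, for every parallel edge ê ∈ P(e) the sum over common 2-cofaces of e and ê vanishes and the sum over common vertices of e and ê reduces to the single term w(v(ê))/√(w(e)·w(ê)), where v(ê) is the unique common vertex of e and ê. -/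
open Finset

noncomputable section
open scoped Classical

variable {V : Type*}

/-- A finite abstract simplicial complex: a finite collection of nonempty finite
subsets closed under taking nonempty subsets. -/
def IsComplex (K : Finset (Finset V)) : Prop :=
  (∀ σ ∈ K, σ.Nonempty) ∧ ∀ σ ∈ K, ∀ τ, τ ⊆ σ → τ.Nonempty → τ ∈ K

/-- The 2-cofaces of `e`: the 2-simplices of `K` containing `e`. -/
def cof2 (K : Finset (Finset V)) (e : Finset V) : Finset (Finset V) :=
  K.filter fun T => T.card = 3 ∧ e ⊆ T

/-- `IsPar K α β` : the 1-simplex `β` of `K` is parallel to `α`, i.e. exactly one of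
(A) some 2-simplex of `K` contains both, (B) some vertex lies in both, holds. -/
def IsPar (K : Finset (Finset V)) (α β : Finset V) : Prop :=
  β ∈ K ∧ β.card = 2 ∧ β ≠ α ∧
    Xor' (∃ γ ∈ K, γ.card = 3 ∧ α ⊆ γ ∧ β ⊆ γ) (α ∩ β).Nonempty

/-- The set of 1-simplices of `K` parallel to `e`. -/
def parSet (K : Finset (Finset V)) (e : Finset V) : Finset (Finset V) :=
  K.filter fun f => IsPar K e f

/-- Original (CW-form) Forman–Ricci curvature of a 1-simplex `e = {v₁, v₂}`. -/
def formanF (K : Finset (Finset V)) (w : Finset V → ℝ) (e : Finset V) : ℝ :=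
  w e * ((∑ T ∈ cof2 K e, w e / w T) + (∑ v ∈ e, w {v} / w e)
    - ∑ f ∈ parSet K e,
        |(∑ T ∈ cof2 K e ∩ cof2 K f, Real.sqrt (w e * w f) / w T)
          - ∑ v ∈ e ∩ f, w {v} / Real.sqrt (w e * w f)|)

/-- Augmented Forman–Ricci curvature of a 1-simplex `e = {v₁, v₂}`. -/
def formanAug (K : Finset (Finset V)) (w : Finset V → ℝ) (e : Finset V) : ℝ :=
  w e * ((∑ v ∈ e, w {v} / w e) + (∑ T ∈ cof2 K e, w e / w T)
    - ∑ f ∈ parSet K e, Real.sqrt (w e / w f))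

/-- A parallel edge meeting `e` has no 2-coface in common with `e`. -/
theorem cof2_inter_cof2_eq_empty {K : Finset (Finset V)} {e f : Finset V}
    (hf : f ∈ parSet K e) (hef : (e ∩ f).Nonempty) : cof2 K e ∩ cof2 K f = ∅ := by
  refine Finset.eq_empty_of_forall_notMem fun T hT => ?_
  simp only [cof2, Finset.mem_inter, Finset.mem_filter] at hT
  obtain ⟨⟨hTK, hcard, heT⟩, -, -, hfT⟩ := hT
  obtain ⟨-, -, -, -, hpar⟩ := Finset.mem_filter.mp hf
  rcases hpar with ⟨-, h⟩ | ⟨-, h⟩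
  · exact h hef
  · exact h ⟨T, hTK, hcard, heT, hfT⟩

/-- on a simplicial complex the Forman–Ricci curvature simplifies: for
each parallel edge the common-2-coface sum vanishes and the common-vertex sum reduces
to the single term at the unique common vertex `vc ê`. -/
theorem formanF_simplified
    (K : Finset (Finset V)) (hK : IsComplex K)
    (w : Finset V → ℝ) (hw : ∀ σ ∈ K, 0 < w σ)
    (e : Finset V) (he : e ∈ K) (hce : e.card = 2)
    (vc : Finset V → V) (hvc : ∀ f ∈ parSet K e, e ∩ f = {vc f}) :
    formanF K w e =
      w e * ((∑ T ∈ cof2 K e, w e / w T) + (∑ v ∈ e, w {v} / w e)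
        - ∑ f ∈ parSet K e, w {vc f} / Real.sqrt (w e * w f)) ∧
    ∀ f ∈ parSet K e,
      cof2 K e ∩ cof2 K f = ∅ ∧
      (∑ v ∈ e ∩ f, w {v} / Real.sqrt (w e * w f))
        = w {vc f} / Real.sqrt (w e * w f) := by
  have hcof : ∀ f ∈ parSet K e, cof2 K e ∩ cof2 K f = ∅ := fun f hf =>
    cof2_inter_cof2_eq_empty hf (hvc f hf ▸ Finset.singleton_nonempty _)
  have hvert : ∀ f ∈ parSet K e, (∑ v ∈ e ∩ f, w {v} / Real.sqrt (w e * w f))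
      = w {vc f} / Real.sqrt (w e * w f) := fun f hf => by
    rw [hvc f hf, Finset.sum_singleton]
  refine ⟨?_, fun f hf => ⟨hcof f hf, hvert f hf⟩⟩
  unfold formanF
  congr 2
  refine Finset.sum_congr rfl fun f hf => ?_
  have hmem : vc f ∈ e :=
    Finset.mem_of_mem_inter_left (hvc f hf ▸ Finset.mem_singleton_self _)
  have hpos : 0 < w {vc f} :=
    hw _ (hK.2 e he _ (Finset.singleton_subset_iff.mpr hmem) (Finset.singleton_nonempty _))
  rw [hcof f hf, hvert f hf, Finset.sum_empty, zero_sub, abs_neg, abs_of_nonneg (by positivity)]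
end
end

section
/- Let K be a finite abstract simplicial complex with weight function w and let e be a 1-simplex of K. Then |F(e) − F_aug(e)| ≤ Σ_{ê ∈ P(e)} √(w(e)/w(ê))·|w(v(ê)) − w(e)|, where v(ê) is the unique common vertex of e and ê. -/
open Finset

noncomputable section
open scoped Classical

variable {V : Type*}

/-- A 1-simplex meeting `e` and parallel to it shares no 2-coface with `e`. -/
lemma cof2_inter_eq_empty {K : Finset (Finset V)} {e f : Finset V} (hf : f ∈ parSet K e)
    (hne : (e ∩ f).Nonempty) : cof2 K e ∩ cof2 K f = ∅ := by
  obtain ⟨-, -, -, -, hx⟩ := Finset.mem_filter.1 hf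
  refine Finset.eq_empty_of_forall_notMem fun T hT => ?_
  simp only [cof2, Finset.mem_inter, Finset.mem_filter] at hT
  obtain ⟨⟨hTK, hT3, heT⟩, -, -, hfT⟩ := hT
  rcases hx with ⟨-, h⟩ | ⟨-, h⟩
  · exact h hne
  · exact h ⟨T, hTK, hT3, heT, hfT⟩

lemma mul_sqrt_div_sub_div_sqrt_mul {a b : ℝ} (ha : 0 < a) (hb : 0 < b) (c : ℝ) :
    a * (Real.sqrt (a / b) - c / Real.sqrt (a * b)) = Real.sqrt (a / b) * (a - c) := by
  have hsa := Real.sqrt_pos.2 ha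
  have hsb := Real.sqrt_pos.2 hb
  have h := Real.sq_sqrt ha.le
  rw [Real.sqrt_div ha.le, Real.sqrt_mul ha.le]
  field_simp
  rw [h]

/-- The discrepancy between the two curvatures as a sum over the parallel 1-simplices. -/
lemma formanF_sub_formanAug {K : Finset (Finset V)} (hK : IsComplex K)
    {w : Finset V → ℝ} (hw : ∀ σ ∈ K, 0 < w σ) {e : Finset V} (he : e ∈ K)
    {vc : Finset V → V} (hvc : ∀ f ∈ parSet K e, e ∩ f = {vc f}) :
    formanF K w e - formanAug K w e =
      ∑ f ∈ parSet K e, Real.sqrt (w e / w f) * (w e - w {vc f}) := by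
  have hterm : ∀ f ∈ parSet K e, Real.sqrt (w e / w f) * (w e - w {vc f}) =
      w e * (Real.sqrt (w e / w f) -
        |(∑ T ∈ cof2 K e ∩ cof2 K f, Real.sqrt (w e * w f) / w T)
          - ∑ v ∈ e ∩ f, w {v} / Real.sqrt (w e * w f)|) := by
    intro f hf
    have hi := hvc f hf
    have hv : {vc f} ∈ K :=
      hK.2 e he _ (hi ▸ Finset.inter_subset_left) (Finset.singleton_nonempty _)
    rw [cof2_inter_eq_empty hf (hi ▸ Finset.singleton_nonempty _), hi, Finset.sum_empty,
      Finset.sum_singleton, zero_sub, abs_neg,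
      abs_of_nonneg (div_nonneg (hw _ hv).le (Real.sqrt_nonneg _)),
      mul_sqrt_div_sub_div_sqrt_mul (hw e he) (hw f (Finset.mem_filter.1 hf).1)]
  rw [Finset.sum_congr rfl hterm, ← Finset.mul_sum, Finset.sum_sub_distrib, formanF, formanAug]
  ring

/-- bound on the discrepancy between the two Forman curvatures. -/
theorem forman_discrepancy_bound
    (K : Finset (Finset V)) (hK : IsComplex K)
    (w : Finset V → ℝ) (hw : ∀ σ ∈ K, 0 < w σ)
    (e : Finset V) (he : e ∈ K) (hce : e.card = 2)
    (vc : Finset V → V) (hvc : ∀ f ∈ parSet K e, e ∩ f = {vc f}) :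
    |formanF K w e - formanAug K w e| ≤
      ∑ f ∈ parSet K e, Real.sqrt (w e / w f) * |w {vc f} - w e| := by
  rw [formanF_sub_formanAug hK hw he hvc]
  refine (Finset.abs_sum_le_sum_abs _ _).trans_eq (Finset.sum_congr rfl fun f _ => ?_)
  rw [abs_mul, abs_of_nonneg (Real.sqrt_nonneg _), abs_sub_comm]
end
end

section
/- Let K be a finite abstract simplicial complex with a weight function w such that w({v}) = 1 for every vertex v (every 0-simplex has weight 1). Then for every 1-simplex e of K, F(e) = F_aug(e) if and only if w(e) = 1 or P(e) = ∅. In particular, a spatial edge with w(e) = 1 always satisfies F(e) = F_aug(e), while an edge with w(e) ≠ 1 that admits at least one parallel edge satisfies F(e) ≠ F_aug(e). -/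
open Finset

noncomputable section
open scoped Classical

variable {V : Type*}

/-- Two distinct edges of a common 2-simplex share a vertex, so parallel edges share exactly one
vertex and lie in no common 2-simplex. -/
lemma IsPar.inter_of_card_eq_two {K : Finset (Finset V)} {e f : Finset V} (hce : e.card = 2)
    (h : IsPar K e f) : cof2 K e ∩ cof2 K f = ∅ ∧ ∃ v, e ∩ f = {v} := by
  obtain ⟨-, hcf, hne, hx⟩ := h
  have hcard := card_union_add_card_inter e f
  have key : (∃ γ ∈ K, γ.card = 3 ∧ e ⊆ γ ∧ f ⊆ γ) → (e ∩ f).Nonempty := by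
    rintro ⟨γ, -, hγ, heγ, hfγ⟩
    have := card_le_card (union_subset heγ hfγ)
    rw [← card_pos]
    omega
  have hx' : (e ∩ f).Nonempty ∧ ¬ ∃ γ ∈ K, γ.card = 3 ∧ e ⊆ γ ∧ f ⊆ γ :=
    hx.resolve_left fun h => h.2 (key h.1)
  refine ⟨eq_empty_of_forall_notMem fun T hT => hx'.2 ?_, card_eq_one.mp ?_⟩
  · simp only [cof2, mem_inter, mem_filter] at hT
    exact ⟨T, hT.1.1, hT.1.2.1, hT.1.2.2, hT.2.2.2⟩
  · have hpos := card_pos.mpr hx'.1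
    have hle : (e ∩ f).card ≤ 2 := hce ▸ card_le_card inter_subset_left
    have hne2 : (e ∩ f).card ≠ 2 := fun h2 => by
      have h₁ := eq_of_subset_of_card_le (inter_subset_left (s₁ := e) (s₂ := f)) (by omega)
      have h₂ := eq_of_subset_of_card_le (inter_subset_right (s₁ := e) (s₂ := f)) (by omega)
      exact hne (h₂.symm.trans h₁)
    omega

/-- With unit vertex weights, the contribution of a parallel edge to the Forman curvature. -/
lemma abs_parallel_term_eq {K : Finset (Finset V)} (hK : IsComplex K) {w : Finset V → ℝ}
    (hv : ∀ v : V, {v} ∈ K → w {v} = 1) {e f : Finset V} (he : e ∈ K) (hce : e.card = 2)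
    (hf : f ∈ parSet K e) :
    |(∑ T ∈ cof2 K e ∩ cof2 K f, Real.sqrt (w e * w f) / w T)
        - ∑ v ∈ e ∩ f, w {v} / Real.sqrt (w e * w f)| = 1 / Real.sqrt (w e * w f) := by
  obtain ⟨hcof, v, hev⟩ := ((mem_filter.mp hf).2).inter_of_card_eq_two hce
  have hvK : {v} ∈ K :=
    hK.2 e he {v} (hev ▸ inter_subset_left) (singleton_nonempty v)
  rw [hcof, hev, sum_empty, sum_singleton, hv v hvK, zero_sub, abs_neg,
    abs_of_nonneg (by positivity)]

lemma sqrt_div_eq_mul_one_div_sqrt_mul {a : ℝ} (ha : 0 < a) (b : ℝ) :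
    Real.sqrt (a / b) = a * (1 / Real.sqrt (a * b)) := by
  rw [Real.sqrt_div ha.le, Real.sqrt_mul ha.le, mul_one_div, div_mul_eq_div_div,
    Real.div_sqrt]

/-- with unit vertex weights, `F(e) = F_aug(e)` iff `w(e) = 1` or
`P(e) = ∅`. -/
theorem forman_eq_iff_unit_vertex_weights
    (K : Finset (Finset V)) (hK : IsComplex K)
    (w : Finset V → ℝ) (hw : ∀ σ ∈ K, 0 < w σ)
    (hv : ∀ v : V, {v} ∈ K → w {v} = 1)
    (e : Finset V) (he : e ∈ K) (hce : e.card = 2) :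
    formanF K w e = formanAug K w e ↔ (w e = 1 ∨ parSet K e = ∅) := by
  have hwe := hw e he
  set S := ∑ f ∈ parSet K e, 1 / Real.sqrt (w e * w f) with hS
  have hF : formanF K w e =
      w e * ((∑ T ∈ cof2 K e, w e / w T) + (∑ v ∈ e, w {v} / w e) - S) := by
    rw [formanF, sum_congr rfl fun f hf => abs_parallel_term_eq hK hv he hce hf]
  have hA : formanAug K w e =
      w e * ((∑ v ∈ e, w {v} / w e) + (∑ T ∈ cof2 K e, w e / w T) - w e * S) := by
    rw [formanAug, sum_congr rfl fun f _ => sqrt_div_eq_mul_one_div_sqrt_mul hwe (w f),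
      ← mul_sum]
  have hS0 : S = 0 ↔ parSet K e = ∅ := by
    constructor
    · intro h
      by_contra hne
      refine (sum_pos (fun f hf => ?_) (nonempty_iff_ne_empty.mpr hne)).ne' h
      have := hw f (mem_filter.mp hf).1
      positivity
    · intro h
      rw [hS, h, sum_empty]
  rw [hF, hA, mul_right_inj' hwe.ne', add_comm, sub_right_inj, eq_comm, mul_left_eq_self₀, hS0]
end
end

section
/- Curvature decomposition into a static component and a prism correction: let K and L be finite abstract simplicial complexes on the same vertex type with L ⊆ K, let w be a weight function on K (and its restriction to L), and let e be a 1-simplex of L. Assume that every 1-simplex of L that is parallel to e within L is also parallel to e within K (equivalently, P_L(e) ⊆ P_K(e)). Then F_K(e) = F_L(e) + w(e)·Σ_{T ∈ cof₂^K(e) \ cof₂^L(e)} w(e)/w(T) − w(e)·Σ_{ê ∈ P_K(e) \ P_L(e)} w(v(ê))/√(w(e)·w(ê)), where F_K and F_L denote the Forman–Ricci curvature of e computed in K and in L respectively, cof₂^K(e) and cof₂^L(e) the 2-cofaces of e in K and in L, P_K(e) and P_L(e) the parallel sets of e in K and in L, and v(ê) the unique common vertex of e and ê. -/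
open Finset

noncomputable section
open scoped Classical

variable {V : Type*}

theorem cof2_mono {K L : Finset (Finset V)} (h : L ⊆ K) (e : Finset V) :
    cof2 L e ⊆ cof2 K e :=
  Finset.filter_subset_filter _ h

/-- If `e` and `f` meet in a single vertex and have no 2-coface in common, the summand of `f` in
the curvature of `e` is its vertex term. -/
theorem abs_parallel_term {K : Finset (Finset V)} {w : Finset V → ℝ} {e f : Finset V} {v : V}
    (hcof : cof2 K e ∩ cof2 K f = ∅) (hv : e ∩ f = {v}) (hw : 0 ≤ w {v}) :
    |(∑ T ∈ cof2 K e ∩ cof2 K f, Real.sqrt (w e * w f) / w T)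
        - ∑ u ∈ e ∩ f, w {u} / Real.sqrt (w e * w f)|
      = w {v} / Real.sqrt (w e * w f) := by
  rw [hcof, hv, Finset.sum_empty, Finset.sum_singleton, zero_sub, abs_neg]
  exact abs_of_nonneg (div_nonneg hw (Real.sqrt_nonneg _))

/-- curvature decomposition of a 1-simplex of a subcomplex `L ⊆ K`
into its static component in `L` plus a prism correction. -/
theorem forman_decomposition_subcomplex
    (K L : Finset (Finset V)) (hK : IsComplex K) (hL : IsComplex L) (hLK : L ⊆ K)
    (w : Finset V → ℝ) (hw : ∀ σ ∈ K, 0 < w σ)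
    (e : Finset V) (he : e ∈ L) (hce : e.card = 2)
    (hP : ∀ f ∈ parSet L e, f ∈ parSet K e)
    (vc : Finset V → V) (hvc : ∀ f ∈ parSet K e, e ∩ f = {vc f}) :
    formanF K w e = formanF L w e
      + w e * (∑ T ∈ cof2 K e \ cof2 L e, w e / w T)
      - w e * (∑ f ∈ parSet K e \ parSet L e, w {vc f} / Real.sqrt (w e * w f)) := by
  have hcof : ∀ f ∈ parSet K e, cof2 K e ∩ cof2 K f = ∅ := fun f hf =>
    cof2_inter_cof2_eq_empty hf (by rw [hvc f hf]; exact Finset.singleton_nonempty _)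
  have hpos : ∀ f ∈ parSet K e, 0 ≤ w {vc f} := fun f hf => by
    have hmem : vc f ∈ e ∩ f := by rw [hvc f hf]; exact Finset.mem_singleton_self _
    exact (hw _ (hK.2 e (hLK he) _
      (Finset.singleton_subset_iff.2 (Finset.mem_inter.1 hmem).1)
      (Finset.singleton_nonempty _))).le
  have hcofL : ∀ f ∈ parSet L e, cof2 L e ∩ cof2 L f = ∅ := fun f hf =>
    Finset.subset_empty.1 <| hcof f (hP f hf) ▸
      Finset.inter_subset_inter (cof2_mono hLK e) (cof2_mono hLK f)
  unfold formanF
  rw [Finset.sum_congr rfl fun f hf => abs_parallel_term (hcof f hf) (hvc f hf) (hpos f hf),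
    Finset.sum_congr rfl fun f hf =>
      abs_parallel_term (hcofL f hf) (hvc f (hP f hf)) (hpos f (hP f hf)),
    ← Finset.sum_sdiff (cof2_mono hLK e), ← Finset.sum_sdiff (show parSet L e ⊆ parSet K e from hP)]
  ring
end
end

section
/- Inclusion–exclusion for the Euler characteristic: let X₁, …, X_N (N ≥ 1) be finite collections of nonempty finite subsets of a type V, and let K = X₁ ∪ ⋯ ∪ X_N. Then χ(K) = Σ_{∅ ≠ A ⊆ {1,…,N}} (−1)^(|A|+1) · χ(⋂_{a ∈ A} X_a), where for any finite collection S of nonempty finite sets, χ(S) = Σ_{σ ∈ S} (−1)^(|σ|−1). -/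
open Finset

noncomputable section
open scoped Classical

/-- Euler characteristic of a finite collection of (nonempty) finite sets:
a simplex `σ` of dimension `|σ| − 1` contributes `(−1)^(|σ|−1)`. -/
def chiS {W : Type*} (S : Finset (Finset W)) : ℤ :=
  ∑ σ ∈ S, (-1 : ℤ) ^ (σ.card - 1)

/-- inclusion–exclusion for the Euler characteristic of a union of
finite collections of nonempty finite sets.  For a nonempty index set `A`, the
subcomplex `(⋃ᵢ Xᵢ).filter (fun σ => ∀ a ∈ A, σ ∈ X a)` is exactly the
intersection `⋂_{a ∈ A} X a`. -/
theorem chi_inclusion_exclusion {V : Type*}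
    (N : ℕ) (hN : 1 ≤ N) (X : Fin N → Finset (Finset V))
    (hne : ∀ i, ∀ σ ∈ X i, σ.Nonempty) :
    chiS (Finset.univ.biUnion X) =
      ∑ A ∈ (Finset.univ : Finset (Fin N)).powerset.filter
          (fun A => A.Nonempty),
        (-1 : ℤ) ^ (A.card + 1) *
          chiS ((Finset.univ.biUnion X).filter fun σ => ∀ a ∈ A, σ ∈ X a) := by
  rw [chiS, inclusion_exclusion_sum_biUnion]
  rw [← Finset.sum_coe_sort ((Finset.univ : Finset (Fin N)).powerset.filter _)]
  refine Finset.sum_congr (by congr!) fun A _ => ?_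
  have hA : A.1.Nonempty := (mem_filter.1 A.2).2
  rw [smul_eq_mul, chiS]
  congr 2
  ext σ
  simp only [mem_inf', mem_filter, mem_biUnion, mem_univ, true_and]
  exact ⟨fun h => ⟨hA.imp fun a ha => h a ha, h⟩, And.right⟩
end
end

section
/- Euler characteristic of the prism complex: let V be a linearly ordered type and σ a nonempty finite subset of V. Then χ(Pr(σ)) = 1, i.e. Σ_{τ ∈ Pr(σ)} (−1)^(|τ|−1) = 1. -/
open Finset

noncomputable section
open scoped Classical

/-- Hatcher's prism complex over a finite linearly ordered set `σ`: the nonempty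
subsets `τ` of `σ × Bool` (bottom copies `(x, false)`, top copies `(x, true)`)
admitting a threshold `c ∈ σ` with every bottom vertex `≤ c` and every top vertex
`≥ c`. -/
def prismCx {V : Type*} [LinearOrder V] (σ : Finset V) :
    Finset (Finset (V × Bool)) :=
  (σ ×ˢ (Finset.univ : Finset Bool)).powerset.filter fun τ =>
    τ.Nonempty ∧ ∃ c ∈ σ,
      (∀ p ∈ τ, p.2 = false → p.1 ≤ c) ∧ (∀ p ∈ τ, p.2 = true → c ≤ p.1)

/-- A simplicial complex (without the empty simplex) that is a cone with apex `a` has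
Euler characteristic `1`: toggling `a` cancels every simplex except `{a}`. -/
theorem chiS_eq_one_of_cone {W : Type*} [DecidableEq W] (S : Finset (Finset W)) (a : W)
    (hne : ∀ τ ∈ S, τ.Nonempty) (ha : {a} ∈ S)
    (hins : ∀ τ ∈ S, insert a τ ∈ S)
    (hers : ∀ τ ∈ S, (τ.erase a).Nonempty → τ.erase a ∈ S) :
    chiS S = 1 := by
  have key : ∑ τ ∈ S.erase {a}, (-1 : ℤ) ^ (τ.card - 1) = 0 := by
    have hers' : ∀ τ ∈ S.erase {a}, (τ.erase a).Nonempty := by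
      intro τ hτ
      obtain ⟨hτa, hτS⟩ := Finset.mem_erase.1 hτ
      rw [Finset.nonempty_iff_ne_empty, Ne, Finset.erase_eq_empty_iff]
      rintro (h | h)
      · exact (hne τ hτS).ne_empty h
      · exact hτa h
    refine Finset.sum_involution (fun τ _ => if a ∈ τ then τ.erase a else insert a τ)
      ?_ ?_ ?_ ?_
    · intro τ hτ
      have hpos := (hers' τ hτ).card_pos
      have hcard := (hne τ (Finset.mem_of_mem_erase hτ)).card_pos
      split_ifs with h
      · rw [Finset.card_erase_of_mem h] at hpos ⊢
        obtain ⟨n, hn⟩ : ∃ n, τ.card = n + 2 := ⟨τ.card - 2, by omega⟩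
        simp [hn, pow_succ]
      · rw [Finset.card_insert_of_notMem h]
        obtain ⟨n, hn⟩ : ∃ n, τ.card = n + 1 := ⟨τ.card - 1, by omega⟩
        simp [hn, pow_succ]
    · intro τ hτ _ heq
      split_ifs at heq with h
      · exact Finset.notMem_erase a τ (heq.symm ▸ h)
      · exact h (heq ▸ Finset.mem_insert_self a τ)
    · intro τ hτ
      have hτS := Finset.mem_of_mem_erase hτ
      split_ifs with h
      · refine Finset.mem_erase.2 ⟨fun heq => ?_, hers τ hτS (hers' τ hτ)⟩
        exact Finset.notMem_erase a τ (heq ▸ Finset.mem_singleton_self a)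
      · refine Finset.mem_erase.2 ⟨fun heq => ?_, hins τ hτS⟩
        have hn := hers' τ hτ
        rw [← Finset.erase_insert_eq_erase, heq] at hn
        simp at hn
    · intro τ hτ
      by_cases h : a ∈ τ <;> simp [h]
  rw [chiS, ← Finset.add_sum_erase S _ ha, key]
  simp

/-- the Euler characteristic of the prism complex over a nonempty
finite set equals 1. -/
theorem chi_prism_eq_one {V : Type*} [LinearOrder V]
    (σ : Finset V) (hσ : σ.Nonempty) :
    chiS (prismCx σ) = 1 := by
  have hle : ∀ c ∈ σ, σ.min' hσ ≤ c := fun c hc => σ.min'_le c hc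
  have hm : σ.min' hσ ∈ σ := σ.min'_mem hσ
  refine chiS_eq_one_of_cone _ (σ.min' hσ, false) ?_ ?_ ?_ ?_
  · intro τ hτ
    exact (Finset.mem_filter.1 hτ).2.1
  · refine Finset.mem_filter.2 ⟨?_, Finset.singleton_nonempty _, _, hm, ?_, ?_⟩
    · simp [hm]
    · intro p hp _
      rw [Finset.mem_singleton.1 hp]
    · simp
  · intro τ hτ
    obtain ⟨hsub, -, c, hc, hbot, htop⟩ := Finset.mem_filter.1 hτ
    refine Finset.mem_filter.2 ⟨?_, Finset.insert_nonempty _ _, c, hc, ?_, ?_⟩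
    · exact Finset.mem_powerset.2
        (Finset.insert_subset (by simp [hm]) (Finset.mem_powerset.1 hsub))
    · intro p hp hpf
      rcases Finset.mem_insert.1 hp with rfl | hp
      · exact hle c hc
      · exact hbot p hp hpf
    · intro p hp hpt
      rcases Finset.mem_insert.1 hp with rfl | hp
      · simp at hpt
      · exact htop p hp hpt
  · intro τ hτ hne
    obtain ⟨hsub, -, c, hc, hbot, htop⟩ := Finset.mem_filter.1 hτ
    exact Finset.mem_filter.2 ⟨Finset.mem_powerset.2
      ((Finset.erase_subset _ _).trans (Finset.mem_powerset.1 hsub)), hne, c, hc,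
      fun p hp => hbot p (Finset.mem_of_mem_erase hp),
      fun p hp => htop p (Finset.mem_of_mem_erase hp)⟩
end
end

section
/- Intersection of prisms is the prism of the intersection: let V be a linearly ordered type and let σ₁, σ₂ be finite subsets of V. Then Pr(σ₁) ∩ Pr(σ₂) = Pr(σ₁ ∩ σ₂). -/
open Finset

noncomputable section
open scoped Classical

/-- A nonempty set of vertices over `σ` lies in the prism complex iff each of its bottom vertices
lies weakly below each of its top vertices; the threshold can be taken to be a vertex of `τ`. -/
theorem mem_prismCx_iff {V : Type*} [LinearOrder V] {σ : Finset V} {τ : Finset (V × Bool)} :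
    τ ∈ prismCx σ ↔ (∀ p ∈ τ, p.1 ∈ σ) ∧ τ.Nonempty ∧
      ∀ p ∈ τ, ∀ q ∈ τ, p.2 = false → q.2 = true → p.1 ≤ q.1 := by
  simp only [prismCx, mem_filter, mem_powerset, subset_iff, mem_product, mem_univ, and_true]
  refine and_congr_right fun hσ => and_congr_right fun hne => ⟨?_, fun h => ?_⟩
  · rintro ⟨c, -, hbot, htop⟩ p hp q hq hp2 hq2
    exact (hbot p hp hp2).trans (htop q hq hq2)
  · rcases (τ.filter fun p => p.2 = false).eq_empty_or_nonempty with hb | hb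
    · obtain ⟨m, hm, hmin⟩ := τ.exists_min_image Prod.fst hne
      exact ⟨m.1, hσ hm, fun p hp hp2 => absurd hp2 (filter_eq_empty_iff.mp hb hp),
        fun p hp _ => hmin p hp⟩
    · obtain ⟨m, hm, hmax⟩ := exists_max_image _ Prod.fst hb
      rw [mem_filter] at hm
      exact ⟨m.1, hσ hm.1, fun p hp hp2 => hmax p (mem_filter.mpr ⟨hp, hp2⟩),
        fun p hp hp2 => h m hm.1 p hp hm.2 hp2⟩

/-- the intersection of two prism complexes is the prism complex of
the intersection. -/
theorem prism_inter {V : Type*} [LinearOrder V] (σ₁ σ₂ : Finset V) :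
    prismCx σ₁ ∩ prismCx σ₂ = prismCx (σ₁ ∩ σ₂) := by
  ext τ
  simp only [mem_inter, mem_prismCx_iff, forall_and]
  tauto
end
end
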